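/- Stokes' theorem for compactly supported Lipschitz (n−1)-forms on ℝⁿ: if f, g₁, …, g_{n-1} : ℝⁿ → ℝ are Lipschitz and f dg₁ ∧ ⋯ ∧ dg_{n-1} has compact support, then ∫_{ℝⁿ} df ∧ dg₁ ∧ ⋯ ∧ dg_{n-1} = 0. -/

import Mathlib

open MeasureTheory

namespace LipStokes

variable {E : Type*} [NormedAddCommGroup E] [NormedSpace ℝ E] [FiniteDimensional ℝ E]
  [MeasurableSpace E] [BorelSpace E]

lemma null_image (μ : Measure E) [μ.IsAddHaarMeasure] {F : E → E} {C : NNReal}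
    (hF : LipschitzWith C F) {s : Set E} (hs : μ s = 0) : μ (F '' s) = 0 := by
  have h1 : μ ≪ (Measure.hausdorffMeasure (Module.finrank ℝ E) : Measure E) :=
    Measure.absolutelyContinuous_isAddHaarMeasure _ _
  have h2 : (Measure.hausdorffMeasure (Module.finrank ℝ E) : Measure E) ≪ μ :=
    Measure.absolutelyContinuous_isAddHaarMeasure _ _
  apply h1
  have h3 := hF.hausdorffMeasure_image_le (d := (Module.finrank ℝ E : ℝ)) (by positivity) s
  rw [h2 hs] at h3
  simpa using h3

lemma det_pos_of_small (A : E →L[ℝ] E) (hA : ‖A‖ < 1) :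
    0 < ((ContinuousLinearMap.id ℝ E) + A).det := by
  have hc : Continuous fun s : ℝ => ((ContinuousLinearMap.id ℝ E) + s • A).det :=
    ContinuousLinearMap.continuous_det.comp (by fun_prop)
  have hne : ∀ s ∈ Set.Icc (0:ℝ) 1, ((ContinuousLinearMap.id ℝ E) + s • A).det ≠ 0 := by
    intro s hs h0
    have h0' : LinearMap.det (((ContinuousLinearMap.id ℝ E) + s • A : E →L[ℝ] E) : E →ₗ[ℝ] E) = 0 :=
      h0
    obtain ⟨x, hx, hx0⟩ := (Submodule.ne_bot_iff _).1 (LinearMap.bot_lt_ker_of_det_eq_zero h0').ne'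
    have hx' : x + s • A x = 0 := by simpa using hx
    have h1 : ‖x‖ ≤ ‖A‖ * ‖x‖ := by
      calc ‖x‖ = ‖s • A x‖ := by rw [← norm_neg (s • A x), ← eq_neg_of_add_eq_zero_left hx']
        _ = |s| * ‖A x‖ := by rw [norm_smul, Real.norm_eq_abs]
        _ ≤ 1 * ‖A x‖ := by
          gcongr
          rw [abs_of_nonneg hs.1]; exact hs.2
        _ ≤ ‖A‖ * ‖x‖ := by rw [one_mul]; exact A.le_opNorm x
    have : 0 < ‖x‖ := norm_pos_iff.2 hx0
    nlinarith
  by_contra hneg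
  push Not at hneg
  have := intermediate_value_Icc' (zero_le_one (α := ℝ)) hc.continuousOn
  have h0 : (0:ℝ) ∈ Set.Icc (((ContinuousLinearMap.id ℝ E) + (1:ℝ) • A).det)
      (((ContinuousLinearMap.id ℝ E) + (0:ℝ) • A).det) := by
    refine ⟨by simpa using hneg, ?_⟩
    simp [ContinuousLinearMap.det]
  obtain ⟨s, hs, hs0⟩ := this h0
  exact hne s hs hs0

lemma integral_det_id_add (μ : Measure E) [μ.IsAddHaarMeasure] {H : E → E} {L : NNReal}
    (hH : LipschitzWith L H) {R : ℝ} (hR : ∀ x ∉ Metric.closedBall (0:E) R, H x = 0)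
    (t : ℝ) (ht : |t| * L < 1) :
    ∫ x in Metric.closedBall (0:E) R, (ContinuousLinearMap.id ℝ E + t • fderiv ℝ H x).det ∂μ
      = μ.real (Metric.closedBall (0:E) R) := by
  set B := Metric.closedBall (0:E) R
  set F : E → E := fun x => x + t • H x with hF
  have hLip : LipschitzWith (‖t‖₊ * L) (fun x => t • H x) := by
    have := (lipschitzWith_smul t (β := E)).comp hH
    exact this
  have hK : ‖t‖₊ * L < 1 := by
    rw [← NNReal.coe_lt_coe]; simpa using ht
  have hFL : LipschitzWith (1 + ‖t‖₊ * L) F := LipschitzWith.id.add hLip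
  have hinj : Function.Injective F := by
    intro x y hxy
    have h1 := hLip.dist_le_mul x y
    have h2 : dist (t • H x) (t • H y) = dist x y := by
      have : x - y = -(t • H x - t • H y) := by
        have : x + t • H x = y + t • H y := hxy
        rw [neg_sub, sub_eq_sub_iff_add_eq_add, this, add_comm]
      rw [dist_eq_norm, dist_eq_norm, this, norm_neg]
    rw [h2] at h1
    by_contra hne
    have h3 : 0 < dist x y := dist_pos.2 hne
    have h4 : ((‖t‖₊ * L : NNReal) : ℝ) < 1 := by exact_mod_cast hK
    nlinarith
  have hsurj : Function.Surjective F := by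
    intro y
    have hl : LipschitzWith (‖t‖₊ * L) (fun x => y - t • H x) := by
      have := (LipschitzWith.const y).sub hLip
      simpa using this
    have hcw : ContractingWith (‖t‖₊ * L) (fun x => y - t • H x) := ⟨hK, hl⟩
    refine ⟨hcw.fixedPoint, ?_⟩
    have := hcw.fixedPoint_isFixedPt
    have h5 : y - t • H hcw.fixedPoint = hcw.fixedPoint := this
    simp only [hF]
    nth_rw 1 [← h5]
    abel
  have hout : ∀ x ∉ B, F x = x := fun x hx => by simp [hF, hR x hx]
  have himg : F '' B = B := by
    ext y
    constructor
    · rintro ⟨x, hx, rfl⟩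
      by_contra hy
      have := hinj (hout _ hy)
      rw [this] at hy
      exact hy hx
    · intro hy
      obtain ⟨x, rfl⟩ := hsurj y
      refine ⟨x, ?_, rfl⟩
      by_contra hx
      rw [hout x hx] at hy
      exact hx hy
  have hBm : MeasurableSet B := Metric.isClosed_closedBall.measurableSet
  set D := {x | DifferentiableAt ℝ H x}
  have hDm : MeasurableSet D := measurableSet_of_differentiableAt ℝ H
  have hD : μ Dᶜ = 0 := hH.ae_differentiableAt
  have hBD : (B ∩ D : Set E) =ᵐ[μ] B := by
    have : D =ᵐ[μ] Set.univ := ae_eq_univ.2 hD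
    simpa using (ae_eq_refl B).inter this
  have hd : ∀ x ∈ B ∩ D, HasFDerivWithinAt F
      (ContinuousLinearMap.id ℝ E + t • fderiv ℝ H x) (B ∩ D) x := by
    intro x hx
    have hx2 : DifferentiableAt ℝ H x := hx.2
    exact ((hasFDerivAt_id x).add (hx2.hasFDerivAt.const_smul t)).hasFDerivWithinAt
  have key := integral_image_eq_integral_abs_det_fderiv_smul μ (hBm.inter hDm) hd
    hinj.injOn (fun _ => (1:ℝ))
  have himg2 : (F '' (B ∩ D) : Set E) =ᵐ[μ] B := by
    have h6 : μ (F '' (B \ D)) = 0 :=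
      null_image μ hFL (measure_mono_null (fun x hx => hx.2) hD)
    have h7 : F '' B = F '' (B ∩ D) ∪ F '' (B \ D) := by
      rw [← Set.image_union, Set.inter_union_sdiff]
    rw [himg] at h7
    have h8 := (union_ae_eq_left_of_ae_eq_empty (s := F '' (B ∩ D)) (ae_eq_empty.2 h6)).symm
    rwa [← h7] at h8
  rw [setIntegral_congr_set himg2, setIntegral_congr_set hBD] at key
  simp only [smul_eq_mul, mul_one, setIntegral_const] at key
  rw [key]
  refine integral_congr_ae (Filter.Eventually.of_forall fun x => ?_)
  refine (abs_of_pos (det_pos_of_small _ ?_)).symm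
  calc ‖t • fderiv ℝ H x‖ = |t| * ‖fderiv ℝ H x‖ := by rw [norm_smul, Real.norm_eq_abs]
    _ ≤ |t| * L := by gcongr; exact norm_fderiv_le_of_lipschitz ℝ hH
    _ < 1 := ht

lemma det_eq_sum (A : E →L[ℝ] E) (v : ℕ → ℝ) (hv : Function.Injective v) :
    A.det = ∑ i ∈ Finset.range (Module.finrank ℝ E + 1),
      (ContinuousLinearMap.id ℝ E + v i • A).det /
        ∏ j ∈ (Finset.range (Module.finrank ℝ E + 1)).erase i, (v i - v j) := by
  let b := Module.finBasis ℝ E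
  let M := LinearMap.toMatrix b b (A : E →ₗ[ℝ] E)
  let P : Polynomial ℝ := Matrix.det ((Polynomial.X : Polynomial ℝ) • M.map Polynomial.C
    + (1 : Matrix _ _ ℝ).map Polynomial.C)
  have hdeg : P.natDegree ≤ Module.finrank ℝ E := by
    have := Polynomial.natDegree_det_X_add_C_le M 1
    rwa [Fintype.card_fin] at this
  have hco : P.coeff (Module.finrank ℝ E) = M.det := by
    have := Polynomial.coeff_det_X_add_C_card M 1
    rwa [Fintype.card_fin] at this
  have hev : ∀ s : ℝ, P.eval s = (ContinuousLinearMap.id ℝ E + s • A).det := by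
    intro s
    have h1 : P.eval s = Matrix.det (s • M + 1) := by
      have := RingHom.map_det (Polynomial.evalRingHom s)
        ((Polynomial.X : Polynomial ℝ) • M.map Polynomial.C
          + (1 : Matrix _ _ ℝ).map Polynomial.C)
      rw [Polynomial.coe_evalRingHom] at this
      rw [this]
      congr 1
      ext i j
      by_cases hij : i = j
      · subst hij; simp; ring
      · simp [hij]; ring
    have h2 : s • M + 1 = LinearMap.toMatrix b b
        ((ContinuousLinearMap.id ℝ E + s • A : E →L[ℝ] E) : E →ₗ[ℝ] E) := by
      simp only [ContinuousLinearMap.toLinearMap_add, ContinuousLinearMap.toLinearMap_smul, map_add, map_smul,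
        ContinuousLinearMap.coe_id, LinearMap.toMatrix_id]
      rw [add_comm]
    rw [h1, h2, LinearMap.det_toMatrix]
  have hA : A.det = P.coeff (Module.finrank ℝ E) := by
    rw [hco, LinearMap.det_toMatrix]
  have := Lagrange.coeff_eq_sum (s := Finset.range (Module.finrank ℝ E + 1)) (v := v)
    hv.injOn (P := P) (by
      refine lt_of_le_of_lt Polynomial.degree_le_natDegree ?_
      rw [Finset.card_range]; exact_mod_cast Nat.lt_succ_of_le hdeg)
  rw [Finset.card_range, Nat.add_sub_cancel] at this
  rw [hA, this]
  simp only [hev]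

lemma integral_det_eq_zero [Nontrivial E] (μ : Measure E) [μ.IsAddHaarMeasure]
    {H : E → E} {L : NNReal} (hH : LipschitzWith L H) (hs : HasCompactSupport H) :
    ∫ x, (fderiv ℝ H x).det ∂μ = 0 := by
  obtain ⟨R, hR⟩ := hs.isCompact.isBounded.subset_closedBall (0:E)
  set B := Metric.closedBall (0:E) R
  have hBm : MeasurableSet B := Metric.isClosed_closedBall.measurableSet
  have hpos : 0 < Module.finrank ℝ E := Module.finrank_pos
  have hout : ∀ x ∉ B, (fderiv ℝ H x).det = 0 := by
    intro x hx
    have : fderiv ℝ H x = 0 := by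
      by_contra h
      exact hx (hR (support_fderiv_subset ℝ h))
    rw [this]
    simp [ContinuousLinearMap.det]
  rw [← setIntegral_eq_integral_of_forall_compl_eq_zero hout]
  have hHR : ∀ x ∉ B, H x = 0 := fun x hx => image_eq_zero_of_notMem_tsupport fun h => hx (hR h)
  let v : ℕ → ℝ := fun i => 1 / (((i:ℝ) + 1) * (L + 1))
  have hL : (0:ℝ) < L + 1 := by positivity
  have hvinj : Function.Injective v := by
    intro i j hij
    simp only [v, one_div, inv_inj] at hij
    have := mul_right_cancel₀ hL.ne' hij
    exact_mod_cast add_right_cancel this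
  have hv1 : ∀ i, |v i| * L < 1 := by
    intro i
    have : 0 < v i := by positivity
    rw [abs_of_pos this]
    simp only [v]
    rw [div_mul_eq_mul_div, div_lt_one (by positivity)]
    have : (0:ℝ) ≤ i := by positivity
    have : (0:ℝ) ≤ L := by positivity
    nlinarith [mul_nonneg ‹(0:ℝ) ≤ (i:ℝ)› this]
  have hint : ∀ t : ℝ, IntegrableOn
      (fun x => (ContinuousLinearMap.id ℝ E + t • fderiv ℝ H x).det) B μ := by
    intro t
    have hBc : μ B < ⊤ := (isCompact_closedBall (0:E) R).measure_lt_top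
    have hcont : Continuous fun A : E →L[ℝ] E => (ContinuousLinearMap.id ℝ E + t • A).det :=
      ContinuousLinearMap.continuous_det.comp (by fun_prop)
    obtain ⟨C, hC⟩ := (isCompact_closedBall (0 : E →L[ℝ] E) L).exists_bound_of_continuousOn
      hcont.continuousOn
    refine IntegrableOn.of_bound hBc ?_ C (Filter.Eventually.of_forall fun x => ?_)
    · exact (hcont.measurable.comp (measurable_fderiv ℝ H)).aestronglyMeasurable
    · apply hC
      simpa using norm_fderiv_le_of_lipschitz ℝ hH
  simp_rw [fun x => det_eq_sum (fderiv ℝ H x) v hvinj]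
  rw [integral_finsetSum _ fun i _ => (hint (v i)).div_const _]
  have hI : ∀ i, ∫ x in B, (ContinuousLinearMap.id ℝ E + v i • fderiv ℝ H x).det ∂μ = μ.real B :=
    fun i => integral_det_id_add μ hH hHR (v i) (hv1 i)
  simp only [integral_div, hI]
  have h0 := Lagrange.coeff_eq_sum (s := Finset.range (Module.finrank ℝ E + 1)) (v := v)
    hvinj.injOn (P := Polynomial.C (μ.real B)) (by
      refine lt_of_le_of_lt Polynomial.degree_C_le ?_
      rw [Finset.card_range]; exact_mod_cast Nat.succ_pos _)
  rw [Finset.card_range, Nat.add_sub_cancel, Polynomial.coeff_C, if_neg hpos.ne'] at h0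
  simp only [Polynomial.eval_C] at h0
  exact h0.symm

/-- A Lipschitz function has zero differential a.e. on its zero set. -/
lemma ae_fderiv_eq_zero (μ : Measure E) [μ.IsAddHaarMeasure] {u : E → ℝ} {L : NNReal}
    (hu : LipschitzWith L u) : ∀ᵐ x ∂μ, u x = 0 → fderiv ℝ u x = 0 := by
  have h1 : LipschitzWith (1 * L) (fun x => ‖u x‖) := lipschitzWith_one_norm.comp hu
  filter_upwards [h1.ae_differentiableAt (μ := μ)] with x hx h0
  have hmin : IsLocalMin (fun x => ‖u x‖) x :=
    Filter.Eventually.of_forall fun y => by simp [h0]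
  have h2 := hx.hasFDerivAt
  rw [hmin.fderiv_eq_zero] at h2
  have h3 : HasFDerivAt u (0 : E →L[ℝ] ℝ) x := by
    rw [hasFDerivAt_iff_isLittleO] at h2 ⊢
    have h4 : (fun x' => ‖u x' - u x - (0 : E →L[ℝ] ℝ) (x' - x)‖) =o[nhds x] fun x' => x' - x := by
      simpa [h0] using h2
    exact h4.of_norm_left
  exact h3.fderiv

lemma lipschitz_mul {χ u : E → ℝ} {L C : NNReal} (hχ : LipschitzWith C χ)
    (hc : HasCompactSupport χ) (hu : LipschitzWith L u) :
    ∃ K, LipschitzWith K (fun x => χ x * u x) := by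
  obtain ⟨M, hM⟩ := hc.exists_bound_of_continuous hχ.continuous
  obtain ⟨N, hN⟩ := hc.isCompact.exists_bound_of_continuousOn hu.continuous.continuousOn
  have key : ∀ x y, x ∈ tsupport χ → dist (χ x * u x) (χ y * u y)
      ≤ (|M| * L + |N| * C) * dist x y := by
    intro x y hx
    have h1 : ‖χ y‖ ≤ |M| := (hM y).trans (le_abs_self _)
    have h2 : ‖u x‖ ≤ |N| := (hN x hx).trans (le_abs_self _)
    have h3 := hχ.dist_le_mul x y
    have h4 := hu.dist_le_mul x y
    rw [dist_eq_norm] at h3 h4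
    calc dist (χ x * u x) (χ y * u y) = ‖χ y * (u x - u y) + u x * (χ x - χ y)‖ := by
          rw [dist_eq_norm]; congr 1; ring
      _ ≤ ‖χ y‖ * ‖u x - u y‖ + ‖u x‖ * ‖χ x - χ y‖ := by
          refine (norm_add_le _ _).trans ?_
          rw [norm_mul, norm_mul]
      _ ≤ |M| * (L * dist x y) + |N| * (C * dist x y) := by gcongr
      _ = _ := by ring
  refine ⟨(|M| * L + |N| * C).toNNReal, LipschitzWith.of_dist_le_mul fun x y => ?_⟩
  rw [Real.coe_toNNReal _ (by positivity)]
  by_cases hx : x ∈ tsupport χ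
  · exact key x y hx
  by_cases hy : y ∈ tsupport χ
  · rw [dist_comm, dist_comm x y]; exact key y x hy
  · simp only [image_eq_zero_of_notMem_tsupport hx, image_eq_zero_of_notMem_tsupport hy]
    simp; positivity

/-- Matrix form of the vanishing of the integral of the Jacobian. -/
lemma integral_jacobian_eq_zero {n : ℕ} (h : Fin (n + 1) → EuclideanSpace ℝ (Fin (n + 1)) → ℝ)
    (L : Fin (n + 1) → NNReal) (hL : ∀ i, LipschitzWith (L i) (h i))
    (hc : ∀ i, HasCompactSupport (h i)) :
    ∫ x, Matrix.det (Matrix.of fun i j : Fin (n + 1) =>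
      fderiv ℝ (h i) x (EuclideanSpace.single j 1)) = 0 := by
  let H : EuclideanSpace ℝ (Fin (n + 1)) → EuclideanSpace ℝ (Fin (n + 1)) :=
    fun x => WithLp.toLp 2 (fun i => h i x)
  have hpi : LipschitzWith (∑ i, L i) (fun x => (fun i => h i x)) := by
    intro x y
    refine edist_pi_le_iff.2 fun i => ((hL i).weaken ?_) x y
    exact Finset.single_le_sum (f := L) (fun _ _ => zero_le) (Finset.mem_univ i)
  have hH := (PiLp.lipschitzWith_toLp 2 (fun _ : Fin (n + 1) => ℝ)).comp hpi
  have hHc : HasCompactSupport H := by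
    refine HasCompactSupport.intro (isCompact_iUnion fun i => (hc i).isCompact) fun x hx => ?_
    ext i
    simp only [Set.mem_iUnion, not_exists] at hx
    exact image_eq_zero_of_notMem_tsupport (f := h i) (hx i)
  rw [← integral_det_eq_zero volume hH hHc]
  refine integral_congr_ae ?_
  filter_upwards [hH.ae_differentiableAt (μ := volume)] with x hx
  have hx' : HasFDerivAt H (fderiv ℝ H x) x := DifferentiableAt.hasFDerivAt hx
  change _ = (fderiv ℝ H x).det
  rw [ContinuousLinearMap.det, ← LinearMap.det_toMatrix
    (EuclideanSpace.basisFun (Fin (n+1)) ℝ).toBasis]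
  congr 1
  ext i j
  have h1 : HasFDerivAt (h i) ((EuclideanSpace.proj i).comp (fderiv ℝ H x)) x :=
    (EuclideanSpace.proj i : EuclideanSpace ℝ (Fin (n+1)) →L[ℝ] ℝ).hasFDerivAt.comp x hx'
  rw [Matrix.of_apply, h1.fderiv, LinearMap.toMatrix_apply]
  simp

end LipStokes

theorem stmt_10 {n : ℕ} (f : EuclideanSpace ℝ (Fin (n + 1)) → ℝ)
    (g : Fin n → EuclideanSpace ℝ (Fin (n + 1)) → ℝ)
    (Lf : NNReal) (hf : LipschitzWith Lf f)
    (Lg : Fin n → NNReal) (hg : ∀ i, LipschitzWith (Lg i) (g i))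
    (hsupp : ∃ K : Set (EuclideanSpace ℝ (Fin (n + 1))), IsCompact K ∧
      ∀ᵐ x : EuclideanSpace ℝ (Fin (n + 1)), x ∉ K →
        ∀ j : Fin (n + 1),
          f x * Matrix.det (Matrix.of fun i k : Fin n =>
            fderiv ℝ (g i) x (EuclideanSpace.single (j.succAbove k) 1)) = (0:ℝ)) :
    ∫ x, Matrix.det (Matrix.of fun i j : Fin (n + 1) =>
        (Fin.cases (fderiv ℝ f x (EuclideanSpace.single j 1))
          (fun i' => fderiv ℝ (g i') x (EuclideanSpace.single j 1)) i : ℝ)) = 0 := by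
  obtain ⟨K, hK, hKae⟩ := hsupp
  obtain ⟨R, hR0, hR⟩ : ∃ R : ℝ, 0 < R ∧ K ⊆ Metric.ball 0 R := by
    obtain ⟨R, hR⟩ := hK.isBounded.subset_ball (0 : EuclideanSpace ℝ (Fin (n + 1)))
    exact ⟨max R 1, by positivity, hR.trans (Metric.ball_subset_ball (le_max_left _ _))⟩
  let χ : ContDiffBump (0 : EuclideanSpace ℝ (Fin (n + 1))) := ⟨R, R + 1, hR0, by linarith⟩
  let ψ : ContDiffBump (0 : EuclideanSpace ℝ (Fin (n + 1))) :=
    ⟨R + 2, R + 3, by linarith, by linarith⟩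
  obtain ⟨C1, hC1⟩ := (χ.contDiff (n := 1)).lipschitzWith_of_hasCompactSupport
    χ.hasCompactSupport one_ne_zero
  obtain ⟨C2, hC2⟩ := (ψ.contDiff (n := 1)).lipschitzWith_of_hasCompactSupport
    ψ.hasCompactSupport one_ne_zero
  obtain ⟨M, hM⟩ := LipStokes.lipschitz_mul hC1 χ.hasCompactSupport hf
  choose N hN using fun i => LipStokes.lipschitz_mul hC2 ψ.hasCompactSupport (hg i)
  let h : Fin (n + 1) → EuclideanSpace ℝ (Fin (n + 1)) → ℝ :=
    Fin.cons (fun x => χ x * f x) (fun i x => ψ x * g i x)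
  have hL : ∀ i, LipschitzWith ((Fin.cons M N : Fin (n + 1) → NNReal) i) (h i) := by
    intro i
    refine Fin.cases ?_ (fun i => ?_) i
    · exact hM
    · exact hN i
  have hc : ∀ i, HasCompactSupport (h i) := by
    intro i
    refine Fin.cases ?_ (fun i => ?_) i
    · exact χ.hasCompactSupport.mul_right
    · exact ψ.hasCompactSupport.mul_right
  rw [← LipStokes.integral_jacobian_eq_zero h _ hL hc]
  refine integral_congr_ae ?_
  filter_upwards [hKae, LipStokes.ae_fderiv_eq_zero volume hf,
    LipStokes.ae_fderiv_eq_zero volume hM] with x hx1 hx2 hx3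
  have hψ : x ∈ Metric.ball 0 (R + 2) → ∀ i, fderiv ℝ (h (Fin.succ i)) x = fderiv ℝ (g i) x := by
    intro hx i
    apply Filter.EventuallyEq.fderiv_eq
    filter_upwards [Metric.isOpen_ball.mem_nhds hx] with y hy
    have : ψ y = 1 := ψ.one_of_mem_closedBall (Metric.ball_subset_closedBall hy)
    simp [h, this]
  by_cases hxK : x ∈ K
  · have hxR := hR hxK
    have hψ' := hψ (Metric.ball_subset_ball (by linarith) hxR)
    have hχ' : fderiv ℝ (h 0) x = fderiv ℝ f x := by
      apply Filter.EventuallyEq.fderiv_eq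
      filter_upwards [Metric.isOpen_ball.mem_nhds hxR] with y hy
      have : χ y = 1 := χ.one_of_mem_closedBall (Metric.ball_subset_closedBall hy)
      simp [h, this]
    congr 1
    ext i j
    refine Fin.cases ?_ (fun i => ?_) i
    · simp [hχ']
    · simp [hψ' i]
  · have hx1 := hx1 hxK
    have hl : Matrix.det (Matrix.of fun i j : Fin (n + 1) =>
        (Fin.cases (fderiv ℝ f x (EuclideanSpace.single j 1))
          (fun i' => fderiv ℝ (g i') x (EuclideanSpace.single j 1)) i : ℝ)) = 0 := by
      rw [Matrix.det_succ_row_zero]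
      refine Finset.sum_eq_zero fun j _ => ?_
      rcases mul_eq_zero.1 (hx1 j) with h0 | h0
      · simp [hx2 h0]
      · rw [mul_eq_zero]; right; exact h0
    have hr : Matrix.det (Matrix.of fun i j : Fin (n + 1) =>
        fderiv ℝ (h i) x (EuclideanSpace.single j 1)) = 0 := by
      rw [Matrix.det_succ_row_zero]
      refine Finset.sum_eq_zero fun j _ => ?_
      have hz : fderiv ℝ (h 0) x = 0 → (-1 : ℝ) ^ (j : ℕ) * (Matrix.of fun i j : Fin (n + 1) =>
          fderiv ℝ (h i) x (EuclideanSpace.single j 1)) 0 j * ((Matrix.of fun i j : Fin (n + 1) =>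
          fderiv ℝ (h i) x (EuclideanSpace.single j 1)).submatrix Fin.succ j.succAbove).det = 0 := by
        intro hz
        simp [hz]
      by_cases hxb : x ∈ Metric.ball 0 (R + 2)
      · rcases mul_eq_zero.1 (hx1 j) with h0 | h0
        · exact hz (hx3 (by simp [h0]))
        · rw [mul_eq_zero]; right
          rw [← h0]
          congr 1
          ext i k
          simp [hψ hxb i]
      · apply hz
        by_contra hne
        have h1 : x ∈ tsupport (h 0) := support_fderiv_subset ℝ hne
        have h2 : x ∈ tsupport χ := tsupport_mul_subset_left h1
        rw [χ.tsupport_eq] at h2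
        apply hxb
        have h3 : χ.rOut = R + 1 := rfl
        rw [h3] at h2
        exact Metric.closedBall_subset_ball (by linarith) h2
    exact hl.trans hr.symm
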